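/- Let K ≥ 2, α ∈ ℝ, and let b : X → ℝ be measurable and integrable with b·s μ-integrable. The ‘b(x_k) only’ half estimator, (1/K) Σ_{k=1}^K [ f(x_k) + α b(x_k) − (1/(K−1)) Σ_{j≠k} f(x_j) ] s(x_k) − α ∫ b(x) s(x) dμ(x), is unbiased: its integral with respect to μ^K equals ∫ f(x) s(x) dμ(x). -/

import Mathlib

open MeasureTheory Finset

/-- Functions of two distinct coordinates are independent under a product measure. -/
theorem indepFun_comp_eval_pi {ι X Y Z : Type*} [Fintype ι] [MeasurableSpace X]
    [MeasurableSpace Y] [MeasurableSpace Z] {μ : Measure X} [IsProbabilityMeasure μ]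
    {f : X → Y} {g : X → Z} {i j : ι} (hf : Measurable f) (hg : Measurable g) (hij : i ≠ j) :
    ProbabilityTheory.IndepFun (fun x : ι → X => f (x i)) (fun x => g (x j))
      (Measure.pi fun _ => μ) :=
  ((ProbabilityTheory.iIndepFun_pi (μ := fun _ : ι => μ) (X := fun _ => id)
    fun _ => aemeasurable_id).indepFun hij).comp hf hg

section EvalSMulEval

variable {ι X E : Type*} [Fintype ι] [MeasurableSpace X] {μ : Measure X} [IsProbabilityMeasure μ]
  [NormedAddCommGroup E] [NormedSpace ℝ E] [MeasurableSpace E] [BorelSpace E]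
  {f : X → ℝ} {g : X → E} {i j : ι}

theorem integrable_eval_smul_eval_pi (hf : Measurable f) (hg : Measurable g)
    (hfInt : Integrable f μ) (hgInt : Integrable g μ) (hij : i ≠ j) :
    Integrable (fun x : ι → X => f (x i) • g (x j)) (Measure.pi fun _ => μ) :=
  (indepFun_comp_eval_pi hf hg hij).integrable_smul
    (integrable_comp_eval hfInt) (integrable_comp_eval hgInt)

theorem integral_eval_smul_eval_pi (hf : Measurable f) (hg : Measurable g)
    (hfInt : Integrable f μ) (hgInt : Integrable g μ) (hij : i ≠ j) :
    ∫ x : ι → X, f (x i) • g (x j) ∂(Measure.pi fun _ => μ) = (∫ y, f y ∂μ) • ∫ y, g y ∂μ := by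
  rw [(indepFun_comp_eval_pi hf hg hij).integral_fun_smul_eq_smul_integral
      (integrable_comp_eval hfInt).aestronglyMeasurable
      (integrable_comp_eval hgInt).aestronglyMeasurable,
    integral_comp_eval (μ := fun _ : ι => μ) hfInt.aestronglyMeasurable,
    integral_comp_eval (μ := fun _ : ι => μ) hgInt.aestronglyMeasurable]

end EvalSMulEval

/-- The `b(x_k)` only half double control variate estimator (with the global correction term)
is unbiased. -/
theorem half_cv_bxk_only_unbiased
    {X : Type*} [MeasurableSpace X] (μ : Measure X) [IsProbabilityMeasure μ]
    (d : ℕ) (s : X → EuclideanSpace ℝ (Fin d)) (f b : X → ℝ)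
    (hs : Measurable s) (hf : Measurable f) (hb : Measurable b)
    (hsInt : Integrable s μ) (hfInt : Integrable f μ) (hbInt : Integrable b μ)
    (hfsInt : Integrable (fun x => f x • s x) μ)
    (hbsInt : Integrable (fun x => b x • s x) μ)
    (hs0 : ∫ x, s x ∂μ = 0)
    (K : ℕ) (hK : 2 ≤ K) (α : ℝ) :
    ∫ x, ((K : ℝ)⁻¹ •
        ∑ k, (f (x k) + α * b (x k)
          - ((K : ℝ) - 1)⁻¹ * ∑ j ∈ univ.erase k, f (x j)) • s (x k)
        - α • ∫ y, b y • s y ∂μ)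
        ∂(Measure.pi fun _ : Fin K => μ)
      = ∫ y, f y • s y ∂μ := by
  set P : Measure (Fin K → X) := Measure.pi fun _ => μ with hP
  have hfs (k : Fin K) : Integrable (fun x : Fin K → X => f (x k) • s (x k)) P :=
    integrable_comp_eval (μ := fun _ : Fin K => μ) hfsInt
  have hbs (k : Fin K) : Integrable (fun x : Fin K → X => α • b (x k) • s (x k)) P :=
    (integrable_comp_eval (μ := fun _ : Fin K => μ) hbsInt).smul α
  have hcross (k j : Fin K) (hj : j ∈ univ.erase k) :
      Integrable (fun x : Fin K → X => f (x j) • s (x k)) P :=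
    integrable_eval_smul_eval_pi hf hs hfInt hsInt (ne_of_mem_erase hj)
  have hsum (k : Fin K) :
      Integrable (fun x : Fin K → X =>
        ((K : ℝ) - 1)⁻¹ • ∑ j ∈ univ.erase k, f (x j) • s (x k)) P :=
    (integrable_finsetSum _ (hcross k)).smul ((K : ℝ) - 1)⁻¹
  have hexpand (k : Fin K) :
      (fun x : Fin K → X => (f (x k) + α * b (x k)
          - ((K : ℝ) - 1)⁻¹ * ∑ j ∈ univ.erase k, f (x j)) • s (x k))
        = fun x => f (x k) • s (x k) + α • b (x k) • s (x k)
          - ((K : ℝ) - 1)⁻¹ • ∑ j ∈ univ.erase k, f (x j) • s (x k) := by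
    funext x
    rw [sub_smul, add_smul, mul_smul, mul_smul, sum_smul]
  have hterm_int (k : Fin K) :
      Integrable (fun x : Fin K → X => (f (x k) + α * b (x k)
          - ((K : ℝ) - 1)⁻¹ * ∑ j ∈ univ.erase k, f (x j)) • s (x k)) P := by
    rw [hexpand]
    exact ((hfs k).add (hbs k)).sub (hsum k)
  have hterm (k : Fin K) :
      ∫ x, (f (x k) + α * b (x k)
          - ((K : ℝ) - 1)⁻¹ * ∑ j ∈ univ.erase k, f (x j)) • s (x k) ∂P
        = ∫ y, f y • s y ∂μ + α • ∫ y, b y • s y ∂μ := by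
    have hzero (j : Fin K) (hj : j ∈ univ.erase k) : ∫ x, f (x j) • s (x k) ∂P = 0 := by
      rw [hP, integral_eval_smul_eval_pi hf hs hfInt hsInt (ne_of_mem_erase hj), hs0, smul_zero]
    have hfs_eval : ∫ x, f (x k) • s (x k) ∂P = ∫ y, f y • s y ∂μ :=
      integral_comp_eval (μ := fun _ : Fin K => μ) hfsInt.aestronglyMeasurable
    have hbs_eval : ∫ x, b (x k) • s (x k) ∂P = ∫ y, b y • s y ∂μ :=
      integral_comp_eval (μ := fun _ : Fin K => μ) hbsInt.aestronglyMeasurable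
    rw [hexpand, integral_sub ((hfs k).fun_add (hbs k)) (hsum k), integral_add (hfs k) (hbs k),
      integral_smul, integral_smul, integral_finsetSum _ (hcross k), sum_eq_zero hzero,
      smul_zero, sub_zero, hfs_eval, hbs_eval]
  have hK0 : (K : ℝ) ≠ 0 := by positivity
  rw [integral_sub ((integrable_finsetSum _ fun k _ => hterm_int k).fun_smul _)
      (integrable_const _), integral_smul, integral_finsetSum _ fun k _ => hterm_int k,
    sum_congr rfl fun k _ => hterm k, sum_const, card_univ, Fintype.card_fin,
    ← Nat.cast_smul_eq_nsmul ℝ, inv_smul_smul₀ hK0, integral_const, probReal_univ, one_smul,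
    add_sub_cancel_right]
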